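/- arXiv:1812.01132 — 2 statements merged into one kernel-verified Lean document; each statement's English description precedes it below -/
import Mathlib

section
/- Every finite Bayesian game (finite players, finite type sets with a common prior of full support, finite action sets) has a Bayes–Nash equilibrium in behavioral strategies. -/
open Classical

/-- The probability simplex on a finite set. -/
def simplex (A : Type*) [Fintype A] : Set (A → ℝ) :=
  {α | (∀ a, 0 ≤ α a) ∧ ∑ a, α a = 1}

/-- Interim expected payoff of player `i` of type `si` when he uses the mixed
action `α`, the other players use the behavioral profile `σ`, and beliefs are
obtained from the common prior `π` by conditioning on `si`. -/
noncomputable def interim {ι : Type*} [Fintype ι] [DecidableEq ι]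
    {S A : ι → Type*} [∀ i, Fintype (S i)] [∀ i, Fintype (A i)]
    (π : (∀ j, S j) → ℝ) (u : ι → (∀ j, A j) → (∀ j, S j) → ℝ)
    (σ : ∀ i, S i → A i → ℝ) (i : ι) (si : S i) (α : A i → ℝ) : ℝ :=
  (∑ s : ∀ j, S j, if s i = si then
      π s * ∑ a : ∀ j, A j,
        (α (a i) * ∏ j ∈ Finset.univ.erase i, σ j (s j) (a j)) * u i a s
    else 0)
    / (∑ s : ∀ j, S j, if s i = si then π s else 0)

/-- Dominating sets for a family of rankings. -/
def Dmt {V P : Type*} (R : V → P → ℕ) (B : Finset P) : Prop :=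
  ∀ y, ∃ i, ∀ b ∈ B, R i y ≤ R i b

theorem Dmt.mono {V P : Type*} {R : V → P → ℕ} {B C : Finset P} (h : Dmt R B) (hC : C ⊆ B) :
    Dmt R C := fun y => by
  obtain ⟨i, hi⟩ := h y
  exact ⟨i, fun b hb => hi b (hC hb)⟩

/-- Points strictly above all minima with index different from `a`. -/
def Abv {V P : Type*} (R : V → P → ℕ) (m : V → P) (a : V) : Set P :=
  {y | ∀ j, j ≠ a → R j (m j) < R j y}

def IsTp {V P : Type*} (R : V → P → ℕ) (m : V → P) (a : V) (x : P) : Prop :=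
  x ∈ Abv R m a ∧ ∀ y ∈ Abv R m a, R a y ≤ R a x

theorem card_tp {V P : Type*} [Fintype P] (R : V → P → ℕ)
    (hR : ∀ i, Function.Injective (R i)) (m : V → P) (a : V) :
    (Finset.univ.filter (fun x => IsTp R m a x)).card
      = if (Abv R m a).Nonempty then 1 else 0 := by
  split_ifs with h
  · obtain ⟨y, hy⟩ := h
    obtain ⟨x, hx, hmax⟩ := Finset.exists_max_image (Finset.univ.filter (fun x => x ∈ Abv R m a))
      (R a) ⟨y, by simpa using hy⟩
    rw [Finset.card_eq_one]
    refine ⟨x, ?_⟩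
    have hx' : x ∈ Abv R m a := by simpa using hx
    have hm' : ∀ y ∈ Abv R m a, R a y ≤ R a x := fun y hy => hmax y (by simpa using hy)
    ext z
    simp only [Finset.mem_filter, Finset.mem_univ, true_and, Finset.mem_singleton]
    constructor
    · intro hz
      exact hR a (le_antisymm (hm' z hz.1) (hz.2 x hx'))
    · rintro rfl
      exact ⟨hx', hm'⟩
  · rw [Finset.card_eq_zero, Finset.filter_eq_empty_iff]
    intro x _ hx
    exact h ⟨x, hx.1⟩

theorem door_count {V P : Type*} [Fintype V] [DecidableEq V] [Fintype P] [DecidableEq P]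
    (R : V → P → ℕ) (hR : ∀ i, Function.Injective (R i)) (τ : Finset P) (hτ : Dmt R τ)
    (hc : τ.card + 1 = Fintype.card V) (hne : τ.Nonempty) :
    ∃ (m : V → P) (a b : V), (∀ i, m i ∈ τ) ∧ (∀ i, ∀ t ∈ τ, R i (m i) ≤ R i t) ∧ a ≠ b ∧
      m a = m b ∧
      (Finset.univ.filter (fun x => x ∉ τ ∧ Dmt R (insert x τ))).card =
        (if (Abv R m a).Nonempty then 1 else 0) + (if (Abv R m b).Nonempty then 1 else 0) := by
  have h1 : ∀ i, ∃ t ∈ τ, ∀ s ∈ τ, R i t ≤ R i s := fun i =>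
    Finset.exists_min_image τ (R i) hne
  choose m hmτ hmin using h1
  have hsurj : ∀ t ∈ τ, ∃ i, m i = t := by
    intro t ht
    obtain ⟨i, hi⟩ := hτ t
    exact ⟨i, hR i (le_antisymm (hmin i t ht) (hi _ (hmτ i)))⟩
  obtain ⟨a, -, b, -, hab, hmab⟩ : ∃ a ∈ (Finset.univ : Finset V), ∃ b ∈ (Finset.univ : Finset V),
      a ≠ b ∧ m a = m b := by
    apply Finset.exists_ne_map_eq_of_card_lt_of_maps_to (t := τ)
    · rw [Finset.card_univ]; omega
    · intro i _; exact hmτ i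
  have hinj : Set.InjOn m (Finset.univ.erase a : Finset V) := by
    apply Finset.injOn_of_surjOn_of_card_le (t := τ)
    · intro i _; exact hmτ i
    · intro t ht
      obtain ⟨i, hi⟩ := hsurj t ht
      by_cases hia : i = a
      · subst hia
        exact ⟨b, by simpa using hab.symm, by rw [← hmab, hi]⟩
      · exact ⟨i, by simpa using hia, hi⟩
    · rw [Finset.card_erase_of_mem (Finset.mem_univ _), Finset.card_univ]; omega
  have huniq : ∀ i j, i ≠ j → m i = m j → i = a ∨ i = b := by
    intro i j hij hm
    by_cases hia : i = a
    · exact Or.inl hia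
    right
    by_cases hja : j = a
    · subst hja
      exact hinj (by simpa using hia) (by simpa using hab.symm) (hm.trans hmab)
    · exact absurd (hinj (by simpa using hia) (by simpa using hja) hm) hij
  have htop_le : ∀ k, ∀ y ∈ Abv R m k, ∀ t ∈ τ, R k y ≤ R k t := by
    intro k y hy t ht
    obtain ⟨i, hi⟩ := hτ y
    by_cases hik : i = k
    · subst hik; exact hi t ht
    · exact absurd (hi _ (hmτ i)) (not_le.mpr (hy i hik))
  have hA4 : ∀ a b, a ≠ b → m a = m b → ∀ x, IsTp R m a x → x ∉ τ ∧ Dmt R (insert x τ) := by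
    intro a b hab hmab x hx
    constructor
    · intro hxt
      obtain ⟨i, hi⟩ := hsurj x hxt
      by_cases hia : i = a
      · subst hia
        have := hx.1 b hab.symm
        rw [← hmab, hi] at this
        exact lt_irrefl _ this
      · have := hx.1 i hia
        rw [hi] at this
        exact lt_irrefl _ this
    · intro y
      by_cases hy : y ∈ Abv R m a
      · refine ⟨a, fun t ht => ?_⟩
        rcases Finset.mem_insert.mp ht with rfl | ht
        · exact hx.2 y hy
        · exact htop_le a y hy t ht
      · simp only [Abv, Set.mem_ofPred_eq, not_forall, not_lt] at hy
        obtain ⟨j, hja, hj⟩ := hy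
        refine ⟨j, fun t ht => ?_⟩
        rcases Finset.mem_insert.mp ht with rfl | ht
        · exact hj.trans (hx.1 j hja).le
        · exact hj.trans (hmin j t ht)
  have hA3 : ∀ x, x ∉ τ → Dmt R (insert x τ) → IsTp R m a x ∨ IsTp R m b x := by
    intro x hx hD
    obtain ⟨k, hk⟩ := hD x
    have hne' : ∀ i, R i x ≠ R i (m i) := fun i h => hx (by rw [hR i h]; exact hmτ i)
    have hkx : R k x < R k (m k) :=
      lt_of_le_of_ne (hk _ (Finset.mem_insert_of_mem (hmτ k))) (hne' k)
    have hs : ∀ t ∈ τ, ∃ i, m i = t ∧ R i (m i) < R i x := by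
      intro t ht
      obtain ⟨i, hi⟩ := hD t
      have hit : m i = t :=
        hR i (le_antisymm (hmin i t ht) (hi _ (Finset.mem_insert_of_mem (hmτ i))))
      refine ⟨i, hit, lt_of_le_of_ne ?_ (hne' i).symm⟩
      rw [hit]; exact hi _ (Finset.mem_insert_self _ _)
    have hxk : x ∈ Abv R m k := by
      intro j hjk
      by_contra hlt
      have hsub : τ ⊆ ((Finset.univ.erase k).erase j).image m := by
        intro t ht
        obtain ⟨i, hi, hi2⟩ := hs t ht
        refine Finset.mem_image.mpr ⟨i, ?_, hi⟩
        simp only [Finset.mem_erase, Finset.mem_univ, and_true]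
        constructor
        · rintro rfl; exact hlt hi2
        · rintro rfl; exact absurd hi2 (not_lt.mpr hkx.le)
      have h1 := Finset.card_le_card hsub
      have h2 := Finset.card_image_le (s := (Finset.univ.erase k).erase j) (f := m)
      rw [Finset.card_erase_of_mem (by simpa using hjk),
        Finset.card_erase_of_mem (Finset.mem_univ _), Finset.card_univ] at h2
      have : 0 < τ.card := hne.card_pos
      omega
    have htop : IsTp R m k x := by
      refine ⟨hxk, fun y hy => ?_⟩
      obtain ⟨i, hi⟩ := hD y
      by_cases hik : i = k
      · subst hik; exact hi x (Finset.mem_insert_self _ _)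
      · exact absurd (hi _ (Finset.mem_insert_of_mem (hmτ i))) (not_le.mpr (hy i hik))
    obtain ⟨i, hi, hi2⟩ := hs (m k) (hmτ k)
    have hki : k ≠ i := by
      rintro rfl; exact absurd hi2 (not_lt.mpr hkx.le)
    rcases huniq k i hki hi.symm with rfl | rfl
    · exact Or.inl htop
    · exact Or.inr htop
  refine ⟨m, a, b, hmτ, hmin, hab, hmab, ?_⟩
  rw [← card_tp R hR m a, ← card_tp R hR m b, ← Finset.card_union_of_disjoint]
  · congr 1
    ext x
    simp only [Finset.mem_filter, Finset.mem_univ, true_and, Finset.mem_union]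
    constructor
    · rintro ⟨h1, h2⟩; exact hA3 x h1 h2
    · rintro (h | h)
      · exact hA4 a b hab hmab x h
      · exact hA4 b a hab.symm hmab.symm x h
  · rw [Finset.disjoint_left]
    intro x hx hx'
    simp only [Finset.mem_filter, Finset.mem_univ, true_and] at hx hx'
    exact absurd (htop_le a x hx.1 _ (hmτ a)) (not_le.mpr (hx'.1 a hab))

theorem room_even {V P : Type*} [Fintype V] [DecidableEq V] [DecidableEq P]
    (c : P → V) (i₀ : V) (B : Finset P) (hB : B.card = Fintype.card V)
    (hn : B.image c ≠ Finset.univ) :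
    Even (B.filter (fun x => (B.erase x).image c = Finset.univ.erase i₀)).card := by
  rcases (B.filter (fun x => (B.erase x).image c = Finset.univ.erase i₀)).eq_empty_or_nonempty
    with h | ⟨x, hx⟩
  · rw [h]; simp
  rw [Finset.mem_filter] at hx
  obtain ⟨hxB, hx⟩ := hx
  have hcx : c x ≠ i₀ := by
    intro h
    apply hn
    rw [← Finset.insert_erase hxB, Finset.image_insert, hx, h,
      Finset.insert_erase (Finset.mem_univ _)]
  have hinj : Set.InjOn c (B.erase x : Finset P) := by
    apply Finset.injOn_of_card_image_eq
    rw [hx, Finset.card_erase_of_mem (Finset.mem_univ _), Finset.card_erase_of_mem hxB, hB,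
      Finset.card_univ]
  have hmem : ∀ v, v ≠ i₀ → ∃ y, y ∈ B ∧ y ≠ x ∧ c y = v := by
    intro v hv
    have : v ∈ (B.erase x).image c := by rw [hx]; simpa using hv
    obtain ⟨y, hy, hyc⟩ := Finset.mem_image.mp this
    rw [Finset.mem_erase] at hy
    exact ⟨y, hy.2, hy.1, hyc⟩
  have hne0 : ∀ y ∈ B, y ≠ x → c y ≠ i₀ := by
    intro y hy hyx
    have : c y ∈ (B.erase x).image c := Finset.mem_image_of_mem c (by simp [hy, hyx])
    rw [hx] at this
    simpa using this
  obtain ⟨y, hyB, hyx, hyc⟩ := hmem (c x) hcx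
  have : B.filter (fun x => (B.erase x).image c = Finset.univ.erase i₀) = {x, y} := by
    ext z
    simp only [Finset.mem_filter, Finset.mem_insert, Finset.mem_singleton]
    constructor
    · rintro ⟨hzB, hz⟩
      by_contra hcon
      push Not at hcon
      have : c z ∈ (B.erase z).image c := by
        rw [hz]; simpa using hne0 z hzB hcon.1
      obtain ⟨w, hw, hwc⟩ := Finset.mem_image.mp this
      rw [Finset.mem_erase] at hw
      by_cases hwx : w = x
      · subst hwx
        exact hcon.2 (hinj (by simp [hzB, hcon.1]) (by simp [hyB, hyx]) (by rw [← hwc, hyc]))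
      · exact hw.1 (hinj (by simp [hw.2, hwx]) (by simp [hzB, hcon.1]) hwc)
    · rintro (rfl | rfl)
      · exact ⟨hxB, hx⟩
      · refine ⟨hyB, ?_⟩
        ext v
        simp only [Finset.mem_image, Finset.mem_erase, Finset.mem_univ, and_true]
        constructor
        · rintro ⟨w, ⟨hw1, hw2⟩, rfl⟩
          by_cases hwx : w = x
          · subst hwx; exact hcx
          · exact hne0 w hw2 hwx
        · intro hv
          obtain ⟨w, hw, hwx, hwc⟩ := hmem v hv
          by_cases hwz : w = z
          · subst hwz
            exact ⟨x, ⟨hyx.symm, hxB⟩, by rw [← hyc, hwc]⟩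
          · exact ⟨w, ⟨hwz, hw⟩, hwc⟩
  rw [this, Finset.card_pair hyx.symm]
  exact even_two

theorem scarf_aux {V P : Type*} [Fintype V] [DecidableEq V] [Nontrivial V]
    [Fintype P] [DecidableEq P]
    (R : V → P → ℕ) (hR : ∀ i, Function.Injective (R i)) (d : V → P)
    (hd1 : ∀ i x, R i (d i) ≤ R i x)
    (hd2 : ∀ i j x, j ≠ i → x ∉ Set.range d → R i x < R i (d j))
    (hT : ∃ x, x ∉ Set.range d)
    (c : P → V) (hcd : ∀ i, c (d i) = i) :
    ∃ B : Finset P, Dmt R B ∧ ∀ k, ∃ b ∈ B, c b = k := by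
  by_contra hcon
  have hno : ∀ B : Finset P, Dmt R B → B.image c ≠ Finset.univ := by
    intro B hB h
    refine hcon ⟨B, hB, fun k => ?_⟩
    have : k ∈ B.image c := by rw [h]; simp
    simpa using this
  have hdinj : Function.Injective d := Function.LeftInverse.injective hcd
  obtain ⟨i₀⟩ : Nonempty V := inferInstance
  have hV : 1 < Fintype.card V := Fintype.one_lt_card
  set doors : Finset (Finset P) := Finset.univ.filter (fun τ =>
    Dmt R τ ∧ τ.card + 1 = Fintype.card V ∧ τ.image c = Finset.univ.erase i₀) with hdoors
  set rooms : Finset (Finset P) := Finset.univ.filter (fun B =>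
    Dmt R B ∧ B.card = Fintype.card V) with hrooms
  have hcount : ∑ τ ∈ doors, (Finset.univ.filter (fun x => x ∉ τ ∧ Dmt R (insert x τ))).card
      = ∑ B ∈ rooms, (B.filter (fun x => (B.erase x).image c = Finset.univ.erase i₀)).card := by
    rw [← Finset.card_sigma, ← Finset.card_sigma]
    refine Finset.card_bij' (fun p _ => ⟨insert p.2 p.1, p.2⟩) (fun p _ => ⟨p.1.erase p.2, p.2⟩)
      ?_ ?_ ?_ ?_
    · rintro ⟨τ, x⟩ h
      simp only [hdoors, hrooms, Finset.mem_sigma, Finset.mem_filter, Finset.mem_univ,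
        true_and] at h ⊢
      obtain ⟨⟨h1, h2, h3⟩, h4, h5⟩ := h
      refine ⟨⟨h5, by rw [Finset.card_insert_of_notMem h4, h2]⟩, Finset.mem_insert_self _ _, ?_⟩
      rw [Finset.erase_insert h4, h3]
    · rintro ⟨B, x⟩ h
      simp only [hdoors, hrooms, Finset.mem_sigma, Finset.mem_filter, Finset.mem_univ,
        true_and] at h ⊢
      obtain ⟨⟨h1, h2⟩, h4, h5⟩ := h
      refine ⟨⟨h1.mono (Finset.erase_subset _ _), ?_, h5⟩, by simp, ?_⟩
      · rw [Finset.card_erase_add_one h4, h2]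
      · rw [Finset.insert_erase h4]; exact h1
    · rintro ⟨τ, x⟩ h
      simp only [hdoors, Finset.mem_sigma, Finset.mem_filter, Finset.mem_univ,
        true_and] at h
      simp only [Finset.erase_insert h.2.1]
    · rintro ⟨B, x⟩ h
      simp only [hrooms, Finset.mem_sigma, Finset.mem_filter, Finset.mem_univ,
        true_and] at h
      simp only [Finset.insert_erase h.2.1]
  have hE : Even (∑ B ∈ rooms,
      (B.filter (fun x => (B.erase x).image c = Finset.univ.erase i₀)).card) := by
    apply Finset.even_sum
    intro B hB
    simp only [hrooms, Finset.mem_filter, Finset.mem_univ, true_and] at hB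
    exact room_even c i₀ B hB.2 (hno B hB.1)
  -- the special door
  set τ₀ : Finset P := (Finset.univ.erase i₀).image d with hτ₀
  have hτ₀c : τ₀.card + 1 = Fintype.card V := by
    rw [hτ₀, Finset.card_image_of_injective _ hdinj, Finset.card_erase_add_one (Finset.mem_univ _),
      Finset.card_univ]
  have hmem₀ : ∀ j, j ≠ i₀ → d j ∈ τ₀ := fun j hj => by
    rw [hτ₀]; exact Finset.mem_image_of_mem _ (by simpa using hj)
  have hmem₀' : ∀ t ∈ τ₀, ∃ j, j ≠ i₀ ∧ d j = t := fun t ht => by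
    rw [hτ₀] at ht; simpa using ht
  have hτ₀D : τ₀ ∈ doors := by
    simp only [hdoors, Finset.mem_filter, Finset.mem_univ, true_and]
    refine ⟨?_, hτ₀c, ?_⟩
    · intro y
      by_cases hy : y ∈ Set.range d
      · obtain ⟨j, rfl⟩ := hy
        exact ⟨j, fun b _ => hd1 j b⟩
      · refine ⟨i₀, fun b hb => ?_⟩
        obtain ⟨j, hj, rfl⟩ := hmem₀' b hb
        exact (hd2 i₀ j y hj hy).le
    · rw [hτ₀, Finset.image_image]
      have : c ∘ d = id := funext hcd
      rw [this, Finset.image_id]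
  have hpos : ∀ τ ∈ doors, τ.Nonempty := by
    intro τ hτ
    simp only [hdoors, Finset.mem_filter, Finset.mem_univ, true_and] at hτ
    rw [← Finset.card_pos]; omega
  have hsp : (Finset.univ.filter (fun x => x ∉ τ₀ ∧ Dmt R (insert x τ₀))).card = 1 := by
    have hD := hτ₀D
    simp only [hdoors, Finset.mem_filter, Finset.mem_univ, true_and] at hD
    obtain ⟨m, a, b, hm, hmin, hab, hmab, hcard⟩ := door_count R hR τ₀ hD.1 hτ₀c (hpos _ hτ₀D)
    have hmj : ∀ j, j ≠ i₀ → m j = d j := fun j hj =>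
      hR j (le_antisymm (hmin j _ (hmem₀ j hj)) (hd1 j _))
    have h1 : (Abv R m i₀).Nonempty := by
      obtain ⟨x, hx⟩ := hT
      refine ⟨x, fun j hj => ?_⟩
      rw [hmj j hj]
      refine lt_of_le_of_ne (hd1 j x) (fun h => hx ⟨j, hR j h⟩)
    have h2 : ∀ k, k ≠ i₀ → m i₀ = m k → ¬ (Abv R m k).Nonempty := by
      rintro k hk hmk ⟨y, hy⟩
      have hy0 := hy i₀ hk.symm
      rw [hmk, hmj k hk] at hy0
      by_cases hyr : y ∈ Set.range d
      · obtain ⟨l, rfl⟩ := hyr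
        by_cases hl : l = i₀
        · subst hl; exact absurd (hd1 l (d k)) (not_le.mpr hy0)
        · by_cases hlk : l = k
          · subst hlk; exact lt_irrefl _ hy0
          · have := hy l hlk
            rw [hmj l hl] at this
            exact lt_irrefl _ this
      · exact absurd (hd2 i₀ k y hk hyr) (not_lt.mpr hy0.le)
    have h3 : a = i₀ ∨ b = i₀ := by
      by_contra h
      push Not at h
      rw [hmj a h.1, hmj b h.2] at hmab
      exact hab (hdinj hmab)
    rw [hcard]
    rcases h3 with rfl | rfl
    · rw [if_pos h1, if_neg (h2 b hab.symm hmab)]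
    · rw [if_pos h1, if_neg (h2 a hab hmab.symm)]
  have hoth : ∀ τ ∈ doors.erase τ₀,
      Even (Finset.univ.filter (fun x => x ∉ τ ∧ Dmt R (insert x τ))).card := by
    intro τ hτ
    rw [Finset.mem_erase] at hτ
    obtain ⟨hne, hτ⟩ := hτ
    have hne' := hpos τ hτ
    simp only [hdoors, Finset.mem_filter, Finset.mem_univ, true_and] at hτ
    obtain ⟨hD, hcd', him⟩ := hτ
    obtain ⟨m, a, b, hm, hmin, hab, hmab, hcard⟩ := door_count R hR τ hD hcd' hne'
    have hx : ∃ x ∈ τ, x ∉ Set.range d := by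
      by_contra hx
      push Not at hx
      apply hne
      apply Finset.eq_of_subset_of_card_le
      · intro t ht
        obtain ⟨j, rfl⟩ := hx t ht
        apply hmem₀
        have : c (d j) ∈ τ.image c := Finset.mem_image_of_mem _ ht
        rw [him, hcd] at this
        simpa using this
      · omega
    obtain ⟨x, hxτ, hx⟩ := hx
    have key : ∀ k, (Abv R m k).Nonempty := by
      intro k
      refine ⟨d k, fun j hj => ?_⟩
      exact lt_of_le_of_lt (hmin j x hxτ) (hd2 j k x hj.symm hx)
    rw [hcard, if_pos (key a), if_pos (key b)]
    exact even_two
  rw [← hcount, ← Finset.add_sum_erase _ _ hτ₀D, hsp] at hE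
  have := Finset.even_sum _ hoth
  rw [Nat.even_add] at hE
  simp [this] at hE

/-- Grid points of the simplex. -/
abbrev Grd (V : Type*) [Fintype V] (N : ℕ) : Type _ :=
  {p : V → Fin (N + 1) // ∑ k, (p k : ℕ) = N}

theorem grid_approx {V : Type*} [Fintype V] [DecidableEq V] [Nontrivial V] (N : ℕ)
    (c : Grd V N → V) :
    ∃ q : Grd V N, ∀ k, ((q.1 k : ℕ) ≤ Fintype.card V) ∨
      ∃ p : Grd V N, c p = k ∧ ∀ j, (p.1 j : ℕ) ≤ q.1 j + Fintype.card V ∧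
        (q.1 j : ℕ) ≤ p.1 j + Fintype.card V := by
  let M := Fintype.card (Grd V N)
  let e : Grd V N ≃ Fin M := Fintype.equivFin _
  let f : V ≃ Fin (Fintype.card V) := Fintype.equivFin _
  let R : V → (V ⊕ Grd V N) → ℕ := fun k x =>
    Sum.elim (fun j => if j = k then 0 else 1 + (N + 1) * M + f j)
      (fun p => 1 + (p.1 k : ℕ) * M + e p) x
  have hlt : ∀ (k : V) (p : Grd V N), (p.1 k : ℕ) * M + e p < (N + 1) * M := by
    intro k p
    have h1 : (p.1 k : ℕ) ≤ N := Nat.lt_succ_iff.mp (p.1 k).2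
    have h2 : (e p : ℕ) < M := (e p).2
    nlinarith
  have hmono : ∀ (k : V) (p q : Grd V N), R k (Sum.inr p) ≤ R k (Sum.inr q) →
      (p.1 k : ℕ) ≤ q.1 k := by
    intro k p q h
    by_contra hc
    push Not at hc
    simp only [R, Sum.elim_inr] at h
    have h2 : (e q : ℕ) < M := (e q).2
    nlinarith
  have hR : ∀ i, Function.Injective (R i) := by
    intro i x y hxy
    rcases x with j | p <;> rcases y with l | q
    · simp only [R, Sum.elim_inl] at hxy
      congr 1
      split_ifs at hxy with h1 h2 h2
      · rw [h1, h2]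
      · omega
      · omega
      · exact f.injective (Fin.ext (by omega))
    · simp only [R, Sum.elim_inl, Sum.elim_inr] at hxy
      have := hlt i q
      split_ifs at hxy <;> omega
    · simp only [R, Sum.elim_inl, Sum.elim_inr] at hxy
      have := hlt i p
      split_ifs at hxy <;> omega
    · have h1 := hmono i p q hxy.le
      have h2 := hmono i q p hxy.ge
      have h3 : (p.1 i : ℕ) = q.1 i := le_antisymm h1 h2
      simp only [R, Sum.elim_inr, h3] at hxy
      congr 1
      exact e.injective (Fin.ext (by omega))
  have hnr : ∀ x : V ⊕ Grd V N, x ∉ Set.range (Sum.inl : V → V ⊕ Grd V N) →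
      ∃ p, x = Sum.inr p := by
    rintro (j | p) h
    · exact absurd ⟨j, rfl⟩ h
    · exact ⟨p, rfl⟩
  -- construct grid points
  have hmk : ∀ (w : V → ℕ), ∑ k, w k = N → ∃ p : Grd V N, ∀ k, (p.1 k : ℕ) = w k := by
    intro w hw
    have hle : ∀ k, w k ≤ N := fun k => by
      rw [← hw]; exact Finset.single_le_sum (f := w) (fun _ _ => Nat.zero_le _) (Finset.mem_univ k)
    exact ⟨⟨fun k => ⟨w k, Nat.lt_succ_iff.mpr (hle k)⟩, by simpa using hw⟩, fun k => rfl⟩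
  obtain ⟨k₀⟩ : Nonempty V := inferInstance
  obtain ⟨y₀, -⟩ := hmk (fun k => if k = k₀ then N else 0) (by simp)
  obtain ⟨B, hB, hcol⟩ := scarf_aux R hR Sum.inl
    (by intro i x; simp [R])
    (by
      intro i j x hj hx
      obtain ⟨p, rfl⟩ := hnr x hx
      have := hlt i p
      simp only [R, Sum.elim_inl, Sum.elim_inr, if_neg hj]
      omega)
    ⟨Sum.inr y₀, by simp⟩ (Sum.elim id c) (fun i => rfl)
  -- dominance facts for grid points
  have hdom : ∀ y : Grd V N, ∃ i, Sum.inl i ∉ B ∧ ∀ p, Sum.inr p ∈ B →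
      (y.1 i : ℕ) ≤ p.1 i := by
    intro y
    obtain ⟨i, hi⟩ := hB (Sum.inr y)
    refine ⟨i, fun hiB => ?_, fun p hp => hmono i y p (hi _ hp)⟩
    have := hi _ hiB
    simp only [R, Sum.elim_inl, Sum.elim_inr, if_true] at this
    omega
  obtain ⟨k₁, hk₁, -⟩ := hdom y₀
  have hcolC : ∀ k, Sum.inl k ∉ B → ∃ p, Sum.inr p ∈ B ∧ c p = k := by
    intro k hk
    obtain ⟨b, hb, hbk⟩ := hcol k
    rcases b with j | p
    · simp only [Sum.elim_inl, id] at hbk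
      subst hbk
      exact absurd hb hk
    · exact ⟨p, hb, hbk⟩
  obtain ⟨q, hqB, -⟩ := hcolC k₁ hk₁
  let σ : Finset (Grd V N) := Finset.univ.filter (fun p => Sum.inr p ∈ B)
  have hσ : ∀ p, p ∈ σ ↔ Sum.inr p ∈ B := fun p => by simp [σ]
  have hex : ∀ k : V, ∃ p ∈ σ, ∀ p' ∈ σ, (p.1 k : ℕ) ≤ p'.1 k := fun k =>
    Finset.exists_min_image σ (fun p => (p.1 k : ℕ)) ⟨q, (hσ q).2 hqB⟩
  choose mp hmpσ hmpmin using hex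
  let m : V → ℕ := fun k => if Sum.inl k ∈ B then 0 else ((mp k).1 k : ℕ)
  have hm_le : ∀ p, Sum.inr p ∈ B → ∀ k, m k ≤ p.1 k := by
    intro p hp k
    simp only [m]
    split_ifs
    · exact Nat.zero_le _
    · exact hmpmin k p ((hσ p).2 hp)
  have hsum : N < ∑ k, m k + Fintype.card V := by
    by_contra hcon
    push Not at hcon
    have hs : ∑ k, (m k + 1) ≤ N := by
      rw [Finset.sum_add_distrib]; simpa using hcon
    let w : V → ℕ := fun k => (m k + 1) + if k = k₁ then N - ∑ k, (m k + 1) else 0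
    obtain ⟨y, hy⟩ := hmk w (by
      simp only [w]
      rw [Finset.sum_add_distrib, Finset.sum_ite_eq' Finset.univ k₁]
      simp only [Finset.mem_univ, if_true]
      omega)
    obtain ⟨i, hi, hiy⟩ := hdom y
    have h1 := hiy (mp i) ((hσ _).1 (hmpσ i))
    rw [hy i] at h1
    have h2 : m i = ((mp i).1 i : ℕ) := by simp only [m, if_neg hi]
    simp only [w] at h1
    omega
  have hupper : ∀ p, Sum.inr p ∈ B → ∀ k, (p.1 k : ℕ) ≤ m k + Fintype.card V := by
    intro p hp k
    have h1 : ∑ j ∈ Finset.univ.erase k, m j ≤ ∑ j ∈ Finset.univ.erase k, (p.1 j : ℕ) :=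
      Finset.sum_le_sum (fun j _ => hm_le p hp j)
    have h2 := Finset.add_sum_erase Finset.univ m (Finset.mem_univ k)
    have h3 := Finset.add_sum_erase Finset.univ (fun j => (p.1 j : ℕ)) (Finset.mem_univ k)
    have h4 := p.2
    omega
  refine ⟨q, fun k => ?_⟩
  by_cases hk : Sum.inl k ∈ B
  · left
    have := hupper q hqB k
    simp only [m, if_pos hk] at this
    omega
  · right
    obtain ⟨p, hp, hpc⟩ := hcolC k hk
    refine ⟨p, hpc, fun j => ?_⟩
    have h1 := hupper q hqB j
    have h2 := hupper p hp j
    have h3 := hm_le q hqB j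
    have h4 := hm_le p hp j
    omega

/-- A KKM type covering theorem. -/
theorem kkm_dual {V : Type*} [Fintype V] [Nonempty V] (g : V → (V → ℝ) → ℝ)
    (hg : ∀ k, Continuous (g k))
    (hcov : ∀ p ∈ stdSimplex ℝ V, ∃ k, 0 ≤ g k p)
    (hface : ∀ p ∈ stdSimplex ℝ V, ∀ k, p k = 0 → 0 ≤ g k p) :
    ∃ p ∈ stdSimplex ℝ V, ∀ k, 0 ≤ g k p := by
  classical
  rcases subsingleton_or_nontrivial V with hV | hV
  · obtain ⟨k₀⟩ : Nonempty V := inferInstance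
    have hp := single_mem_stdSimplex ℝ k₀
    obtain ⟨k, hk⟩ := hcov _ hp
    exact ⟨_, hp, fun j => by rw [Subsingleton.elim j k]; exact hk⟩
  let n : ℝ := Fintype.card V
  let toS : ∀ N : ℕ, Grd V (N + 1) → V → ℝ := fun N p k => (p.1 k : ℕ) / ((N : ℝ) + 1)
  have hpos : ∀ N : ℕ, (0 : ℝ) < (N : ℝ) + 1 := fun N => by positivity
  have htoS : ∀ N p, toS N p ∈ stdSimplex ℝ V := by
    intro N p
    refine ⟨fun k => by simp only [toS]; positivity, ?_⟩
    simp only [toS]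
    rw [← Finset.sum_div, div_eq_one_iff_eq (hpos N).ne']
    have := p.2
    exact_mod_cast this
  have hstep : ∀ N : ℕ, ∃ x ∈ stdSimplex ℝ V, ∀ k, x k ≤ n / ((N : ℝ) + 1) ∨
      ∃ z : V → ℝ, 0 ≤ g k z ∧ ∀ j, |z j - x j| ≤ n / ((N : ℝ) + 1) := by
    intro N
    choose c hc using fun p : Grd V (N + 1) => hcov _ (htoS N p)
    obtain ⟨q, hq⟩ := grid_approx (N + 1) c
    refine ⟨toS N q, htoS N q, fun k => ?_⟩
    rcases hq k with h | ⟨p, hpc, hp⟩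
    · left
      simp only [toS, n]
      have : ((q.1 k : ℕ) : ℝ) ≤ Fintype.card V := by exact_mod_cast h
      gcongr
    · right
      refine ⟨toS N p, hpc ▸ hc p, fun j => ?_⟩
      have h1 : ((p.1 j : ℕ) : ℝ) ≤ (q.1 j : ℕ) + Fintype.card V := by exact_mod_cast (hp j).1
      have h2 : ((q.1 j : ℕ) : ℝ) ≤ (p.1 j : ℕ) + Fintype.card V := by exact_mod_cast (hp j).2
      simp only [toS, n]
      rw [← sub_div, abs_div, abs_of_pos (hpos N)]
      gcongr
      rw [abs_le]
      constructor <;> linarith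
  choose x hxS hx using hstep
  obtain ⟨a, haS, φ, hφ, hlim⟩ := (isCompact_stdSimplex ℝ V).tendsto_subseq hxS
  refine ⟨a, haS, fun k => ?_⟩
  by_contra hneg
  push Not at hneg
  have hak : 0 < a k := by
    refine lt_of_le_of_ne (haS.1 k) (fun h => ?_)
    exact absurd (hface a haS k h.symm) (not_le.mpr hneg)
  have hopen : {y | g k y < 0} ∈ nhds a := (hg k).continuousAt.eventually (gt_mem_nhds hneg)
  obtain ⟨δ, hδ, hball⟩ := Metric.mem_nhds_iff.mp hopen
  have hsmall : Filter.Tendsto (fun N : ℕ => n / ((φ N : ℝ) + 1)) Filter.atTop (nhds 0) := by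
    have h1 : Filter.Tendsto (fun N : ℕ => n / ((N : ℝ) + 1)) Filter.atTop (nhds 0) :=
by
      have h := (tendsto_one_div_add_atTop_nhds_zero_nat (𝕜 := ℝ)).const_mul n
      simpa [div_eq_mul_inv] using h
    exact h1.comp hφ.tendsto_atTop
  have e1 : ∀ᶠ N in Filter.atTop, n / ((φ N : ℝ) + 1) < min (δ / 2) (a k / 2) :=
    hsmall.eventually (gt_mem_nhds (by positivity))
  have e2 : ∀ᶠ N in Filter.atTop, dist ((x ∘ φ) N) a < min (δ / 2) (a k / 2) :=
    hlim.eventually (Metric.ball_mem_nhds a (by positivity))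
  obtain ⟨N, h1, h2⟩ := (e1.and e2).exists
  rw [lt_min_iff] at h1 h2
  simp only [Function.comp] at h2
  rcases hx (φ N) k with h | ⟨z, hz, hzx⟩
  · have h3 := (dist_le_pi_dist (x (φ N)) a k).trans_lt h2.2
    rw [Real.dist_eq, abs_lt] at h3
    linarith [h3.1, h1.2]
  · have h3 : dist z (x (φ N)) ≤ n / ((φ N : ℝ) + 1) := by
      rw [dist_pi_le_iff (by positivity)]
      intro j
      rw [Real.dist_eq]
      exact hzx j
    have h4 : z ∈ Metric.ball a δ := by
      rw [Metric.mem_ball]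
      linarith [dist_triangle z (x (φ N)) a, h1.1, h2.1]
    have h5 := hball h4
    simp only [Set.mem_ofPred_eq] at h5
    linarith

/-- A finite Fan type inequality. -/
theorem fan_finite {V : Type*} [Fintype V] [Nonempty V] (f : V → (V → ℝ) → ℝ)
    (hf : ∀ k, Continuous (f k))
    (h0 : ∀ p ∈ stdSimplex ℝ V, ∑ k, p k * f k p = 0) :
    ∃ p ∈ stdSimplex ℝ V, ∀ k, f k p ≤ 0 := by
  obtain ⟨p, hp, hg⟩ := kkm_dual
    (fun k p => max (f k p) 0 - p k * ∑ j, max (f j p) 0)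
    (by intro k; fun_prop)
    (by
      intro p hp
      by_contra hcon
      push Not at hcon
      have h1 : ∑ k, (max (f k p) 0 - p k * ∑ j, max (f j p) 0) < 0 :=
        Finset.sum_neg (fun k _ => hcon k) Finset.univ_nonempty
      rw [Finset.sum_sub_distrib, ← Finset.sum_mul, hp.2] at h1
      simp at h1)
    (by
      intro p hp k hk
      simp [hk])
  refine ⟨p, hp, ?_⟩
  set s := ∑ j, max (f j p) 0 with hs
  have hs0 : 0 ≤ s := Finset.sum_nonneg (fun j _ => le_max_right _ _)
  have hle : ∀ j, max (f j p) 0 ≤ s := fun j =>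
    Finset.single_le_sum (f := fun j => max (f j p) 0) (fun j _ => le_max_right _ _)
      (Finset.mem_univ j)
  rcases hs0.eq_or_lt with h | h
  · intro k
    exact (le_max_left _ _).trans ((hle k).trans h.symm.le)
  · exfalso
    have hfk : ∀ k, 0 < p k → 0 < f k p := by
      intro k hk
      have h1 := hg k
      have h2 : 0 < p k * s := mul_pos hk h
      have h3 : 0 < max (f k p) 0 := by linarith
      rcases lt_max_iff.mp h3 with h4 | h4
      · exact h4
      · exact absurd h4 (lt_irrefl _)
    obtain ⟨k, -, hk⟩ : ∃ k ∈ Finset.univ, 0 < p k := by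
      apply Finset.exists_lt_of_sum_lt (f := fun _ => (0 : ℝ)) 
      rw [hp.2]; simp
    have : 0 < ∑ k, p k * f k p := by
      apply Finset.sum_pos'
      · intro j _
        rcases (hp.1 j).eq_or_lt with h | h
        · rw [← h]; simp
        · exact (mul_pos h (hfk j h)).le
      · exact ⟨k, Finset.mem_univ k, mul_pos hk (hfk k hk)⟩
    linarith [h0 p hp]

theorem interim_linear {ι : Type*} [Fintype ι] [DecidableEq ι]
    {S A : ι → Type*} [∀ i, Fintype (S i)] [∀ i, Fintype (A i)]
    (π : (∀ j, S j) → ℝ) (u : ι → (∀ j, A j) → (∀ j, S j) → ℝ)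
    (σ : ∀ i, S i → A i → ℝ) (i : ι) (si : S i) (α : A i → ℝ) :
    interim π u σ i si α =
      ∑ b, α b * interim π u σ i si (fun a => if a = b then 1 else 0) := by
  unfold interim
  simp only [← mul_div_assoc]
  rw [← Finset.sum_div]
  congr 1
  simp only [Finset.mul_sum]
  rw [Finset.sum_comm]
  refine Finset.sum_congr rfl (fun s _ => ?_)
  split_ifs
  · simp only [Finset.mul_sum]
    rw [Finset.sum_comm]
    refine Finset.sum_congr rfl (fun a _ => ?_)
    rw [Finset.sum_eq_single (a i)]
    · simp; ring
    · intro b _ hb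
      simp [Ne.symm hb]
    · simp
  · simp

/-- Every finite Bayesian game with a full-support common prior has a
Bayes–Nash equilibrium in behavioral strategies. -/
theorem stmt10 {ι : Type*} [Fintype ι] [DecidableEq ι]
    {S A : ι → Type*} [∀ i, Fintype (S i)] [∀ i, Fintype (A i)]
    [∀ i, Nonempty (A i)]
    (π : (∀ j, S j) → ℝ) (hπpos : ∀ s, 0 < π s) (hπ1 : ∑ s, π s = 1)
    (u : ι → (∀ j, A j) → (∀ j, S j) → ℝ) :
    ∃ σ : ∀ i, S i → A i → ℝ,
      (∀ i (si : S i), σ i si ∈ simplex (A i)) ∧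
      ∀ i (si : S i), ∀ α ∈ simplex (A i),
        interim π u σ i si α ≤ interim π u σ i si (σ i si) := by
  let V := ∀ i, S i → A i
  let X : (V → ℝ) → ∀ i, S i → A i → ℝ := fun p i si a => ∑ k : V, p k * if k i si = a then 1 else 0
  let G : (V → ℝ) → ∀ i, S i → A i → ℝ := fun p i si b =>
    interim π u (X p) i si (fun a => if a = b then 1 else 0)
  have hG : ∀ i si b, Continuous (fun p => G p i si b) := by
    intro i si b
    simp only [G, interim, X]
    apply Continuous.div_const
    refine continuous_finsetSum _ (fun s _ => ?_)
    split_ifs <;> fun_prop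
  have hX : ∀ i si b, Continuous (fun p => X p i si b) := by
    intro i si b
    simp only [X]
    fun_prop
  have hXs : ∀ p ∈ stdSimplex ℝ V, ∀ i si, X p i si ∈ simplex (A i) := by
    intro p hp i si
    refine ⟨fun a => Finset.sum_nonneg (fun k _ => mul_nonneg (hp.1 k) (by split_ifs <;> simp)), ?_⟩
    simp only [X]
    rw [Finset.sum_comm]
    simp only [← Finset.mul_sum]
    simpa using hp.2
  have hsw : ∀ p i si, ∑ k : V, p k * G p i si (k i si) = ∑ b, X p i si b * G p i si b := by
    intro p i si
    simp only [X, Finset.sum_mul]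
    rw [Finset.sum_comm]
    refine Finset.sum_congr rfl (fun k _ => ?_)
    rw [Finset.sum_eq_single (k i si)]
    · simp
    · intro b _ hb
      simp [Ne.symm hb]
    · simp
  obtain ⟨p, hp, hfp⟩ := fan_finite (V := V)
    (fun k p => ∑ i, ∑ si, (G p i si (k i si) - ∑ b, X p i si b * G p i si b))
    (by
      intro k
      refine continuous_finsetSum _ (fun i _ => continuous_finsetSum _ (fun si _ => ?_))
      exact (hG _ _ _).sub (continuous_finsetSum _ (fun b _ => (hX _ _ _).mul (hG _ _ _))))
    (by
      intro p hp
      simp only [Finset.mul_sum]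
      rw [Finset.sum_comm]
      refine Finset.sum_eq_zero (fun i _ => ?_)
      rw [Finset.sum_comm]
      refine Finset.sum_eq_zero (fun si _ => ?_)
      simp only [mul_sub]
      rw [Finset.sum_sub_distrib, hsw, ← Finset.sum_mul, hp.2, one_mul, sub_self])
  refine ⟨X p, hXs p hp, ?_⟩
  have hbest : ∀ i (si : S i), ∃ b, ∀ a, G p i si a ≤ G p i si b := fun i si =>
    Finite.exists_max (G p i si)
  choose k hk using hbest
  have hav : ∀ i (si : S i), ∀ α ∈ simplex (A i), ∑ b, α b * G p i si b ≤ G p i si (k i si) := by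
    intro i si α hα
    calc ∑ b, α b * G p i si b ≤ ∑ b, α b * G p i si (k i si) :=
          Finset.sum_le_sum (fun b _ => mul_le_mul_of_nonneg_left (hk i si b) (hα.1 b))
      _ = G p i si (k i si) := by rw [← Finset.sum_mul, hα.2, one_mul]
  have hnn : ∀ i (si : S i), 0 ≤ G p i si (k i si) - ∑ b, X p i si b * G p i si b :=
    fun i si => sub_nonneg.mpr (hav i si _ (hXs p hp i si))
  have hle : ∀ i (si : S i), G p i si (k i si) ≤ ∑ b, X p i si b * G p i si b := by
    intro i si
    have h1 := Finset.single_le_sum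
      (f := fun si => G p i si (k i si) - ∑ b, X p i si b * G p i si b)
      (fun si _ => hnn i si) (Finset.mem_univ si)
    have h2 := Finset.single_le_sum
      (f := fun i => ∑ si, (G p i si (k i si) - ∑ b, X p i si b * G p i si b))
      (fun i _ => Finset.sum_nonneg (fun si _ => hnn i si)) (Finset.mem_univ i)
    have h3 := hfp k
    linarith
  intro i si α hα
  rw [interim_linear π u (X p) i si α, interim_linear π u (X p) i si (X p i si)]
  exact (hav i si α hα).trans (hle i si)
end

section
/- Kakutani fixed-point corollary for best-response correspondences: a correspondence from a nonempty compact convex subset of ℝⁿ to itself that is nonempty-valued, convex-valued, and has closed graph admits a fixed point. -/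
open Set Filter Topology MeasureTheory

theorem aux_det_interp {n : ℕ} (v : Fin (n+1) → ℝ) (hv : Function.Injective v)
    (A : EuclideanSpace ℝ (Fin n) →L[ℝ] EuclideanSpace ℝ (Fin n)) :
    (1 + A).det = ∑ j, (Lagrange.basis Finset.univ v j).eval 1 * (1 + v j • A).det := by
  set b := (EuclideanSpace.basisFun (Fin n) ℝ).toBasis
  set M := LinearMap.toMatrix b b (A : EuclideanSpace ℝ (Fin n) →ₗ[ℝ] EuclideanSpace ℝ (Fin n)) with hM
  set q : Polynomial ℝ := Matrix.det ((Polynomial.X : Polynomial ℝ) • M.map Polynomial.C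
    + (1 : Matrix (Fin n) (Fin n) ℝ).map Polynomial.C) with hq
  have hqe : ∀ t : ℝ, q.eval t = (1 + t • A).det := by
    intro t
    have h1 : (Polynomial.evalRingHom t).mapMatrix ((Polynomial.X : Polynomial ℝ) • M.map Polynomial.C
        + (1 : Matrix (Fin n) (Fin n) ℝ).map Polynomial.C) = 1 + t • M := by
      ext i j
      by_cases hij : i = j
      · subst hij; simp; ring
      · simp [Matrix.one_apply_ne hij]; ring
    rw [hq, ← Polynomial.coe_evalRingHom, RingHom.map_det, h1, ContinuousLinearMap.det,
      ← LinearMap.det_toMatrix b]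
    congr 1
    rw [ContinuousLinearMap.toLinearMap_add, ContinuousLinearMap.toLinearMap_smul, map_add, map_smul, hM]
    congr 1
    exact (LinearMap.toMatrix_one b).symm
  have hdeg : q.degree < (Finset.univ : Finset (Fin (n+1))).card := by
    have h1 := Polynomial.natDegree_det_X_add_C_le M 1
    rw [Fintype.card_fin] at h1
    refine lt_of_le_of_lt (Polynomial.degree_le_of_natDegree_le h1) ?_
    simp only [Finset.card_univ, Fintype.card_fin]
    exact_mod_cast Nat.lt_succ_self n
  have h2 := Lagrange.eq_interpolate (f := q) hv.injOn hdeg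
  have h3 := congrArg (Polynomial.eval 1) h2
  rw [Lagrange.interpolate_apply, Polynomial.eval_finsetSum, hqe] at h3
  simp only [Polynomial.eval_mul, Polynomial.eval_C, hqe, one_smul] at h3
  rw [h3]
  exact Finset.sum_congr rfl fun j _ => mul_comm _ _

theorem aux_det_pos {n : ℕ}
    (A : EuclideanSpace ℝ (Fin n) →L[ℝ] EuclideanSpace ℝ (Fin n)) (hA : ‖A‖ < 1) :
    0 < (1 + A).det := by
  have hne : ∀ s ∈ Icc (0:ℝ) 1, (1 + s • A).det ≠ 0 := by
    intro s hs
    have h1 : ‖-(s • A)‖ < 1 := by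
      rw [norm_neg, norm_smul, Real.norm_of_nonneg hs.1]
      nlinarith [norm_nonneg A, hs.2, hs.1]
    have h2 : IsUnit (1 + s • A) := by
      have := isUnit_one_sub_of_norm_lt_one h1
      rwa [sub_neg_eq_add] at this
    have h3 := (h2.map (ContinuousLinearMap.toLinearMapRingHom (R₁ := ℝ))).map
      (LinearMap.det (M := EuclideanSpace ℝ (Fin n)) (A := ℝ))
    exact h3.ne_zero
  have hc : ContinuousOn (fun s : ℝ => (1 + s • A).det) (Icc 0 1) := by
    apply Continuous.continuousOn
    exact ContinuousLinearMap.continuous_det.comp (by fun_prop)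
  by_contra hneg
  push Not at hneg
  have := intermediate_value_Icc' (zero_le_one) hc
  have h0 : (0:ℝ) ∈ Icc ((1 + (1:ℝ) • A).det) ((1 + (0:ℝ) • A).det) := by
    constructor
    · simpa using hneg
    · simp [ContinuousLinearMap.det]
  obtain ⟨s, hs, hs'⟩ := this h0
  exact hne s hs hs'

theorem aux_surj {E : Type*} [NormedAddCommGroup E] [CompleteSpace E] [NormedSpace ℝ E]
    (g : E → E) (R L t : ℝ) (hL : 0 ≤ L) (ht : 0 ≤ t) (htL : t * L < 1)
    (hg : ∀ x, ‖x‖ = R → g x = 0)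
    (hlip : ∀ x y, ‖x‖ ≤ R → ‖y‖ ≤ R → ‖g x - g y‖ ≤ L * ‖x - y‖)
    (y : E) (hy : ‖y‖ < R) : ∃ x, ‖x‖ < R ∧ x + t • g x = y := by
  classical
  set G : E → E := fun x => if ‖x‖ ≤ R then g x else 0 with hG
  have hmix : ∀ x z, ‖x‖ ≤ R → R < ‖z‖ → ‖g x‖ ≤ L * ‖x - z‖ := by
    intro x z hx hz
    have hc : ContinuousOn (fun s : ℝ => ‖x + s • (z - x)‖) (Icc 0 1) := by fun_prop
    have := intermediate_value_Icc (zero_le_one) hc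
    obtain ⟨s, hs, hs'⟩ := this (show R ∈ _ from ⟨by simpa using hx, by simpa using hz.le⟩)
    have h1 := hlip x (x + s • (z - x)) hx hs'.le
    rw [hg _ hs', sub_zero] at h1
    refine h1.trans (mul_le_mul_of_nonneg_left ?_ hL)
    rw [sub_add_cancel_left, norm_neg, norm_smul, Real.norm_of_nonneg hs.1, norm_sub_rev]
    exact mul_le_of_le_one_left (norm_nonneg _) hs.2
  have hGl : ∀ x z, ‖G x - G z‖ ≤ L * ‖x - z‖ := by
    intro x z
    simp only [hG]
    split_ifs with h1 h2 h2
    · exact hlip x z h1 h2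
    · rw [sub_zero]; exact hmix x z h1 (not_le.1 h2)
    · rw [zero_sub, norm_neg, norm_sub_rev]; exact hmix z x h2 (not_le.1 h1)
    · simp; positivity
  have hcon : ContractingWith (Real.toNNReal (t * L)) (fun x => y - t • G x) := by
    refine ⟨by rw [← NNReal.coe_lt_coe, Real.coe_toNNReal _ (by positivity)]; exact htL, LipschitzWith.of_dist_le_mul fun x z => ?_⟩
    rw [dist_eq_norm, dist_eq_norm, sub_sub_sub_cancel_left, ← smul_sub, norm_smul,
      Real.norm_of_nonneg ht, norm_sub_rev x z]
    calc _ ≤ t * (L * ‖z - x‖) := mul_le_mul_of_nonneg_left (hGl z x) ht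
      _ = _ := by rw [Real.coe_toNNReal _ (by positivity), mul_assoc]
  have : Nonempty E := ⟨y⟩
  obtain ⟨x, hx⟩ : ∃ x, y - t • G x = x := ⟨_, hcon.fixedPoint_isFixedPt⟩
  have hxR : ‖x‖ < R := by
    by_contra hcon
    push Not at hcon
    have : G x = 0 := by
      simp only [hG]
      split_ifs with h
      · exact hg x (le_antisymm h hcon)
      · rfl
    rw [this, smul_zero, sub_zero] at hx
    rw [hx] at hy; linarith
  refine ⟨x, hxR, ?_⟩
  have : G x = g x := by simp [hG, hxR.le]
  rw [this] at hx
  exact (sub_eq_iff_eq_add.1 hx).symm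

theorem aux_vol {n : ℕ} (g : EuclideanSpace ℝ (Fin n) → EuclideanSpace ℝ (Fin n))
    (hgc : ContDiff ℝ 1 g) (R L t : ℝ) (hL : 0 ≤ L) (ht : 0 ≤ t) (htL : t * L < 1)
    (hg : ∀ x, ‖x‖ = R → g x = 0)
    (hb : ∀ x, ‖x‖ < R → ‖x + t • g x‖ < R)
    (hd : ∀ x, ‖x‖ ≤ R → ‖fderiv ℝ g x‖ ≤ L)
    (hlip : ∀ x y, ‖x‖ ≤ R → ‖y‖ ≤ R → ‖g x - g y‖ ≤ L * ‖x - y‖) :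
    ∫ x in Metric.ball 0 R, (1 + t • fderiv ℝ g x).det
      = volume.real (Metric.ball (0 : EuclideanSpace ℝ (Fin n)) R) := by
  have himg : (fun x => x + t • g x) '' Metric.ball 0 R = Metric.ball 0 R := by
    ext y
    simp only [mem_image, mem_ball_zero_iff]
    constructor
    · rintro ⟨x, hx, rfl⟩; exact hb x hx
    · intro hy; exact aux_surj g R L t hL ht htL hg hlip y hy
  have hinj : InjOn (fun x => x + t • g x) (Metric.ball 0 R) := by
    intro x hx z hz hxz
    rw [mem_ball_zero_iff] at hx hz
    simp only at hxz
    have h1 : x - z = t • (g z - g x) := by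
      rw [smul_sub, sub_eq_sub_iff_add_eq_add, hxz, add_comm]
    have h2 := congrArg norm h1
    rw [norm_smul, Real.norm_of_nonneg ht, norm_sub_rev] at h2
    have h3 := hlip z x hz.le hx.le
    have h4 : ‖z - x‖ = 0 := by
      nlinarith [norm_nonneg (z - x), mul_le_mul_of_nonneg_left h3 ht]
    exact (sub_eq_zero.1 (norm_eq_zero.1 h4)).symm
  have hder : ∀ x ∈ Metric.ball (0 : EuclideanSpace ℝ (Fin n)) R,
      HasFDerivWithinAt (fun x => x + t • g x) (1 + t • fderiv ℝ g x) (Metric.ball 0 R) x := by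
    intro x _
    have := ((hgc.differentiable one_ne_zero) x).hasFDerivAt
    exact ((hasFDerivAt_id x).add (this.const_smul t)).hasFDerivWithinAt
  have key := integral_image_eq_integral_abs_det_fderiv_smul volume measurableSet_ball hder hinj
    (fun _ => (1:ℝ))
  rw [himg] at key
  simp only [smul_eq_mul, mul_one, integral_const, measureReal_restrict_apply_univ] at key
  rw [key]
  refine setIntegral_congr_fun measurableSet_ball fun x hx => ?_
  rw [mem_ball_zero_iff] at hx
  refine (abs_of_pos (aux_det_pos _ ?_)).symm
  rw [norm_smul, Real.norm_of_nonneg ht]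
  exact lt_of_le_of_lt (mul_le_mul_of_nonneg_left (hd x hx.le) ht) htL

theorem aux_no_retract {n : ℕ} (f : EuclideanSpace ℝ (Fin n) → EuclideanSpace ℝ (Fin n))
    (hf : ContDiff ℝ 1 f) (R : ℝ) (hR : 0 < R) (hnorm : ∀ x, ‖f x‖ = R)
    (hid : ∀ x, ‖x‖ = R → f x = x) : False := by
  set g : EuclideanSpace ℝ (Fin n) → EuclideanSpace ℝ (Fin n) := fun x => f x - x with hgdef
  have hgc : ContDiff ℝ 1 g := hf.sub contDiff_id
  have hg : ∀ x, ‖x‖ = R → g x = 0 := fun x hx => by simp [hgdef, hid x hx]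
  have hdc : Continuous (fderiv ℝ g) := hgc.continuous_fderiv one_ne_zero
  obtain ⟨L, hLb⟩ := (isCompact_closedBall (0 : EuclideanSpace ℝ (Fin n)) R).exists_bound_of_continuousOn
    hdc.continuousOn
  have hL : 0 ≤ L := (norm_nonneg _).trans (hLb 0 (by simp [hR.le]))
  have hd : ∀ x, ‖x‖ ≤ R → ‖fderiv ℝ g x‖ ≤ L := fun x hx => hLb x (by simpa using hx)
  have hlip : ∀ x y, ‖x‖ ≤ R → ‖y‖ ≤ R → ‖g x - g y‖ ≤ L * ‖x - y‖ := by
    intro x y hx hy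
    exact (convex_closedBall (0 : EuclideanSpace ℝ (Fin n)) R).norm_image_sub_le_of_norm_fderiv_le
      (fun z _ => (hgc.differentiable one_ne_zero) z) hLb (by simpa using hy) (by simpa using hx)
  set v : Fin (n+1) → ℝ := fun j => 1 / ((L + 2) * (j + 1)) with hvdef
  have hv0 : ∀ j, 0 < v j := fun j => by simp only [hvdef]; positivity
  have hvle : ∀ j, v j * (L + 2) ≤ 1 := fun j => by
    simp only [hvdef]
    rw [div_mul_eq_mul_div, div_le_one (by positivity)]
    have : (0:ℝ) ≤ (j:ℕ) := Nat.cast_nonneg _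
    nlinarith
  have hvinj : Function.Injective v := by
    intro i j hij
    simp only [hvdef] at hij
    have hi : (0:ℝ) < (i:ℕ) + 1 := by positivity
    have hj : (0:ℝ) < (j:ℕ) + 1 := by positivity
    have hL2 : L + 2 ≠ 0 := by positivity
    field_simp at hij
    have : ((i:ℕ):ℝ) = (j:ℕ) := by linarith
    exact Fin.ext (by exact_mod_cast this)
  have hvol : ∀ j, ∫ x in Metric.ball 0 R, (1 + v j • fderiv ℝ g x).det
      = volume.real (Metric.ball (0 : EuclideanSpace ℝ (Fin n)) R) := by
    intro j
    refine aux_vol g hgc R L (v j) hL (hv0 j).le (by nlinarith [hv0 j, hvle j]) hg ?_ hd hlip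
    intro x hx
    have h1 : x + v j • g x = (1 - v j) • x + v j • f x := by
      simp only [hgdef]; module
    have h2 : v j < 1 := by nlinarith [hv0 j, hvle j]
    rw [h1]
    calc _ ≤ ‖(1 - v j) • x‖ + ‖v j • f x‖ := norm_add_le _ _
      _ = (1 - v j) * ‖x‖ + v j * R := by
        rw [norm_smul, norm_smul, Real.norm_of_nonneg (hv0 j).le, hnorm,
          Real.norm_of_nonneg (by linarith)]
      _ < R := by nlinarith
  have hint : ∀ j, IntegrableOn (fun x => (Lagrange.basis Finset.univ v j).eval 1 *
      (1 + v j • fderiv ℝ g x).det) (Metric.ball 0 R) volume := by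
    intro j
    have hc : Continuous (fun x => (Lagrange.basis Finset.univ v j).eval 1 *
      (1 + v j • fderiv ℝ g x).det) :=
      continuous_const.mul (ContinuousLinearMap.continuous_det.comp (by fun_prop))
    exact (hc.continuousOn.integrableOn_compact
      (isCompact_closedBall (0 : EuclideanSpace ℝ (Fin n)) R)).mono_set Metric.ball_subset_closedBall
  have hzero : ∀ x, (1 + fderiv ℝ g x).det = 0 := by
    intro x
    have hfd := ((hf.differentiable one_ne_zero) x).hasFDerivAt
    have h1 : fderiv ℝ g x = fderiv ℝ f x - 1 := (hfd.sub (hasFDerivAt_id x)).fderiv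
    rw [h1, add_sub_cancel]
    have h2 : ∀ w, inner ℝ (f x) (fderiv ℝ f x w) = 0 := by
      intro w
      have h3 := hfd.norm_sq
      have h4 : HasFDerivAt (fun y => ‖f y‖ ^ 2) (0 : EuclideanSpace ℝ (Fin n) →L[ℝ] ℝ) x := by
        simp only [hnorm]; exact hasFDerivAt_const _ _
      have h5 := congrArg (fun T => T w) (h3.unique h4)
      simpa using h5
    by_contra hne
    have hu : IsUnit (LinearMap.det (fderiv ℝ f x : EuclideanSpace ℝ (Fin n) →ₗ[ℝ] EuclideanSpace ℝ (Fin n))) :=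
      isUnit_iff_ne_zero.2 hne
    obtain ⟨w, hw'⟩ := ((Module.End.isUnit_iff _).1
      ((LinearMap.isUnit_iff_isUnit_det _).2 hu)).2 (f x)
    replace hw' : fderiv ℝ f x w = f x := hw'
    have := h2 w
    rw [hw', real_inner_self_eq_norm_sq, hnorm] at this
    nlinarith
  have hfin : ∫ x in Metric.ball (0 : EuclideanSpace ℝ (Fin n)) R, (1 + fderiv ℝ g x).det
      = volume.real (Metric.ball (0 : EuclideanSpace ℝ (Fin n)) R) := by
    rw [integral_congr_ae (Eventually.of_forall fun x => aux_det_interp v hvinj (fderiv ℝ g x))]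
    rw [integral_finsetSum _ (fun j _ => hint j)]
    simp_rw [integral_const_mul, hvol]
    rw [← Finset.sum_mul, ← Polynomial.eval_finsetSum,
      Lagrange.sum_basis hvinj.injOn Finset.univ_nonempty]
    simp
  simp only [hzero, integral_zero] at hfin
  have hpos : 0 < volume.real (Metric.ball (0 : EuclideanSpace ℝ (Fin n)) R) :=
    ENNReal.toReal_pos (Metric.measure_ball_pos volume _ hR).ne' measure_ball_lt_top.ne
  linarith

theorem aux_brouwer_bdd {n : ℕ} (f : EuclideanSpace ℝ (Fin n) → EuclideanSpace ℝ (Fin n))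
    (hf : Continuous f) (C : ℝ) (hC : ∀ x, ‖f x‖ ≤ C) : ∃ x, f x = x := by
  by_contra hno
  push Not at hno
  have hC0 : 0 ≤ C := (norm_nonneg _).trans (hC 0)
  set R := C + 1 with hR
  -- cutoff
  set χ : EuclideanSpace ℝ (Fin n) → ℝ := fun x => max 0 (min 1 (C + 1 - ‖x‖)) with hχ
  have hχ0 : ∀ x, 0 ≤ χ x := fun x => le_max_left _ _
  have hχ1 : ∀ x, χ x ≤ 1 := fun x => max_le zero_le_one (min_le_left _ _)
  have hχc : Continuous χ := by fun_prop
  set h : EuclideanSpace ℝ (Fin n) → EuclideanSpace ℝ (Fin n) := fun x => χ x • f x with hh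
  have hhc : Continuous h := hχc.smul hf
  have hhz : ∀ x, R ≤ ‖x‖ → h x = 0 := by
    intro x hx
    have : χ x = 0 := max_eq_left ((min_le_right _ _).trans (by linarith))
    simp [hh, this]
  have hne : ∀ x, x - h x ≠ 0 := by
    intro x hx
    rw [sub_eq_zero] at hx
    have h1 : ‖x‖ ≤ C := by
      calc ‖x‖ = ‖h x‖ := congrArg norm hx
        _ = χ x * ‖f x‖ := by rw [hh, norm_smul, Real.norm_of_nonneg (hχ0 x)]
        _ ≤ 1 * C := mul_le_mul (hχ1 x) (hC x) (norm_nonneg _) zero_le_one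
        _ = C := one_mul C
    have h2 : χ x = 1 := by
      simp only [hχ]
      rw [min_eq_left (by linarith), max_eq_right zero_le_one]
    apply hno x
    rw [hh] at hx; simp only [h2, one_smul] at hx
    exact hx.symm
  obtain ⟨G, hGs, hGa, hGsupp⟩ := hhc.exists_contDiff_approx 1 (ε := fun x => ‖x - h x‖)
    (by fun_prop) (fun x => norm_pos_iff.2 (hne x))
  have hGz : ∀ x, R ≤ ‖x‖ → G x = 0 := by
    intro x hx
    by_contra hc
    exact hGsupp hc (hhz x hx)
  have hHne : ∀ x, x - G x ≠ 0 := by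
    intro x hx
    have := hGa x
    rw [← sub_eq_zero.1 hx, dist_eq_norm] at this
    exact lt_irrefl _ this
  have hRpos : 0 < R := by linarith
  have hHs : ContDiff ℝ 1 (fun x => x - G x) := contDiff_id.sub (by exact_mod_cast hGs)
  refine aux_no_retract (fun x => (R * ‖x - G x‖⁻¹) • (x - G x)) ?_ R hRpos ?_ ?_
  · refine ContDiff.smul (contDiff_const.mul (ContDiff.inv (hHs.norm ℝ hHne) ?_)) hHs
    exact fun x => norm_ne_zero_iff.2 (hHne x)
  · intro x
    have := norm_ne_zero_iff.2 (hHne x)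
    rw [norm_smul, norm_mul, norm_inv, norm_norm, Real.norm_of_nonneg hRpos.le]
    field_simp
  · intro x hx
    simp only [hGz x hx.ge, sub_zero, hx]
    rw [mul_inv_cancel₀ hRpos.ne', one_smul]

theorem aux_brouwer {n : ℕ} (f : (Fin n → ℝ) → (Fin n → ℝ))
    (hf : Continuous f) (K : Set (Fin n → ℝ)) (hK : IsCompact K) (hfK : ∀ x, f x ∈ K) :
    ∃ x, f x = x := by
  set e := (EuclideanSpace.equiv (Fin n) ℝ)
  obtain ⟨C, hC⟩ := (hK.image e.symm.continuous).isBounded.exists_norm_le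
  obtain ⟨x, hx⟩ := aux_brouwer_bdd (fun x => e.symm (f (e x)))
    (e.symm.continuous.comp (hf.comp e.continuous)) C
    (fun x => hC _ ⟨_, hfK _, rfl⟩)
  refine ⟨e x, ?_⟩
  rw [← e.symm_apply_eq]
  exact hx

theorem aux_approx {n : ℕ} (K : Set (Fin n → ℝ))
    (hKne : K.Nonempty) (hKc : IsCompact K) (hKconv : Convex ℝ K)
    (s : (Fin n → ℝ) → (Fin n → ℝ)) (hs : ∀ x ∈ K, s x ∈ K) (ε : ℝ) (hε : 0 < ε) :
    ∃ x ∈ K, x ∈ convexHull ℝ (s '' (K ∩ Metric.ball x ε)) := by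
  classical
  obtain ⟨y0, hy0⟩ := hKne
  obtain ⟨T, hTK, hT⟩ := hKc.elim_nhds_subcover (fun x => Metric.ball x ε)
    (fun x _ => Metric.ball_mem_nhds x hε)
  set w : (Fin n → ℝ) → (Fin n → ℝ) → ℝ := fun a x => max 0 (ε - dist x a) with hw
  have hw0 : ∀ a x, 0 ≤ w a x := fun a x => le_max_left _ _
  have hwc : ∀ a, Continuous (w a) := fun a => by fun_prop
  set d : (Fin n → ℝ) → ℝ := fun x => Metric.infDist x K with hd
  have hd0 : ∀ x, 0 ≤ d x := fun x => Metric.infDist_nonneg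
  have hdc : Continuous d := Metric.continuous_infDist_pt K
  set W : (Fin n → ℝ) → ℝ := fun x => d x + ∑ a ∈ T, w a x with hW
  have hsum0 : ∀ x, 0 ≤ ∑ a ∈ T, w a x := fun x => Finset.sum_nonneg fun a _ => hw0 a x
  have hWpos : ∀ x, 0 < W x := by
    intro x
    by_cases hx : x ∈ K
    · obtain ⟨a, ha, hxa⟩ := mem_iUnion₂.1 (hT hx)
      have h1 : 0 < w a x := lt_max_of_lt_right (sub_pos.2 hxa)
      have h2 := Finset.single_le_sum (f := fun a => w a x) (fun a _ => hw0 a x) ha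
      have := hd0 x
      simp only [hW]; linarith
    · have h1 : 0 < d x := (hKc.isClosed.notMem_iff_infDist_pos ⟨y0, hy0⟩).1 hx
      have := hsum0 x
      simp only [hW]; linarith
  have hWc : Continuous W := hdc.add (continuous_finsetSum _ fun a _ => hwc a)
  set f : (Fin n → ℝ) → (Fin n → ℝ) := fun x =>
    (W x)⁻¹ • (d x • y0 + ∑ a ∈ T, w a x • s a) with hf
  have hfc : Continuous f := by
    refine (hWc.inv₀ fun x => (hWpos x).ne').smul ((hdc.smul continuous_const).add ?_)
    exact continuous_finsetSum _ fun a _ => (hwc a).smul continuous_const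
  have hfK : ∀ x, f x ∈ K := by
    intro x
    have h1 := hKconv.sum_mem (t := Finset.insertNone T)
      (w := fun o : Option (Fin n → ℝ) => (W x)⁻¹ * o.elim (d x) (fun a => w a x))
      (z := fun o : Option (Fin n → ℝ) => o.elim y0 s) ?_ ?_ ?_
    · convert h1 using 1
      simp [hf, Finset.sum_insertNone, Finset.smul_sum, smul_smul]
    · rintro (_ | a) _
      · exact mul_nonneg (inv_nonneg.2 (hWpos x).le) (hd0 x)
      · exact mul_nonneg (inv_nonneg.2 (hWpos x).le) (hw0 a x)
    · rw [← Finset.mul_sum, Finset.sum_insertNone]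
      exact inv_mul_cancel₀ (hWpos x).ne'
    · rintro (_ | a) ha
      · exact hy0
      · exact hs a (hTK a (by simpa using ha))
  obtain ⟨x, hx⟩ := aux_brouwer f hfc K hKc hfK
  have hxK : x ∈ K := hx ▸ hfK x
  refine ⟨x, hxK, ?_⟩
  have hdx : d x = 0 := Metric.infDist_zero_of_mem hxK
  have hWx : W x = ∑ a ∈ T, w a x := by simp [hW, hdx]
  have h2 : T.centerMass (fun a => w a x) s ∈ convexHull ℝ (s '' (K ∩ Metric.ball x ε)) := by
    rw [← Finset.centerMass_filter_ne_zero]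
    refine Finset.centerMass_mem_convexHull _ (fun a _ => hw0 a x) ?_ ?_
    · rw [Finset.sum_filter_ne_zero, ← hWx]; exact hWpos x
    · intro a ha
      rw [Finset.mem_filter] at ha
      refine ⟨a, ⟨hTK a ha.1, ?_⟩, rfl⟩
      by_contra hc
      apply ha.2
      rw [Metric.mem_ball, dist_comm] at hc
      exact max_eq_left (by linarith)
  convert h2
  rw [Finset.centerMass, ← hWx]
  conv_lhs => rw [← hx]
  simp [hf, hdx]

/-- Kakutani fixed-point corollary: a correspondence from a nonempty compact
convex subset of `ℝⁿ` to itself that is nonempty-valued, convex-valued, and has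
closed graph admits a fixed point. -/
theorem stmt18 {n : ℕ} (K : Set (Fin n → ℝ))
    (hKne : K.Nonempty) (hKc : IsCompact K) (hKconv : Convex ℝ K)
    (F : (Fin n → ℝ) → Set (Fin n → ℝ))
    (hFsub : ∀ x ∈ K, F x ⊆ K)
    (hFne : ∀ x ∈ K, (F x).Nonempty)
    (hFconv : ∀ x ∈ K, Convex ℝ (F x))
    (hgraph : IsClosed {p : (Fin n → ℝ) × (Fin n → ℝ) | p.1 ∈ K ∧ p.2 ∈ F p.1}) :
    ∃ x ∈ K, x ∈ F x := by
  classical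
  choose! s hs using hFne
  have hu : ∀ k : ℕ, (0:ℝ) < 1 / ((k:ℝ) + 1) := fun k => Nat.one_div_pos_of_nat
  choose u huK huh using fun k : ℕ => aux_approx K hKne hKc hKconv s
    (fun x hx => hFsub x hx (hs x hx)) _ (hu k)
  obtain ⟨x, hxK, φ, hφ, hlim⟩ := hKc.tendsto_subseq huK
  refine ⟨x, hxK, ?_⟩
  have hFcl : IsClosed (F x) := by
    have := hgraph.preimage (f := fun y : Fin n → ℝ => (x, y)) (by fun_prop)
    convert this using 1
    ext y; simp [hxK]
  -- upper hemicontinuity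
  have husc : ∀ δ > 0, ∃ η > 0, ∀ z ∈ K, dist z x < η → F z ⊆ Metric.thickening δ (F x) := by
    intro δ hδ
    by_contra hcon
    push Not at hcon
    have hcon' : ∀ k : ℕ, ∃ z ∈ K, dist z x < 1 / ((k:ℝ) + 1) ∧ ∃ y ∈ F z,
        y ∉ Metric.thickening δ (F x) := by
      intro k
      obtain ⟨z, hz, hzx, hn⟩ := hcon _ (hu k)
      exact ⟨z, hz, hzx, not_subset.1 hn⟩
    choose z hzK hzx y hy hyn using hcon'
    obtain ⟨y', hy'K, ψ, hψ, hylim⟩ := hKc.tendsto_subseq (fun k => hFsub _ (hzK k) (hy k))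
    have hzlim : Tendsto z atTop (𝓝 x) := by
      rw [tendsto_iff_dist_tendsto_zero]
      exact squeeze_zero (fun _ => dist_nonneg) (fun k => (hzx k).le)
        tendsto_one_div_add_atTop_nhds_zero_nat
    have hp := (hzlim.comp hψ.tendsto_atTop).prodMk_nhds hylim
    have hmem := hgraph.mem_of_tendsto hp (Eventually.of_forall fun k => ⟨hzK _, hy _⟩)
    have hcl : y' ∈ (Metric.thickening δ (F x))ᶜ :=
      Metric.isOpen_thickening.isClosed_compl.mem_of_tendsto hylim
        (Eventually.of_forall fun k => hyn _)
    exact hcl (Metric.self_subset_thickening hδ _ hmem.2)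
  rw [← hFcl.closure_eq, Metric.closure_eq_iInter_cthickening]
  refine mem_iInter₂.2 fun δ hδ => ?_
  obtain ⟨η, hη, hη'⟩ := husc δ hδ
  refine Metric.isClosed_cthickening.mem_of_tendsto hlim ?_
  have he1 : ∀ᶠ k in atTop, dist ((u ∘ φ) k) x < η / 2 :=
    (tendsto_iff_dist_tendsto_zero.1 hlim).eventually_lt_const (by linarith)
  have he2 : ∀ᶠ k in atTop, 1 / (((φ k : ℕ) : ℝ) + 1) < η / 2 :=
    (tendsto_one_div_add_atTop_nhds_zero_nat.comp hφ.tendsto_atTop).eventually_lt_const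
      (by linarith)
  filter_upwards [he1, he2] with k hk1 hk2
  apply Metric.thickening_subset_cthickening
  refine convexHull_min ?_ ((hFconv x hxK).thickening δ) (huh (φ k))
  rintro _ ⟨a, ⟨haK, ha⟩, rfl⟩
  refine hη' a haK ?_ (hs a haK)
  have := dist_triangle a (u (φ k)) x
  rw [Metric.mem_ball] at ha
  simp only [Function.comp] at hk1
  linarith
end
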